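/- Let L be a finite orthomodular lattice and let x₁, …, xₙ ∈ L be distinct elements, all different from ⊥. Then there exist a finite orthomodular lattice M, an OML embedding h : L → M, and distinct atoms a₁, …, aₙ of M, none of which lies in the range of h, such that for every i and every x ∈ L, aᵢ ≤ h x if and only if xᵢ ≤ x, and for all i, j, aᵢ ≤ aⱼᶜ if and only if xᵢ ≤ xⱼᶜ. -/

import Mathlib

/-- A bounded lattice with an orthocomplementation. -/
class Ortholattice (α : Type*) extends Lattice α, BoundedOrder α, Compl α where
  compl_invol : ∀ a : α, aᶜᶜ = a
  compl_le_compl_of_le : ∀ a b : α, a ≤ b → bᶜ ≤ aᶜ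
  inf_compl_bot : ∀ a : α, a ⊓ aᶜ = ⊥

/-- An ortholattice satisfying the orthomodular law. -/
class OrthomodularLattice (α : Type*) extends Ortholattice α where
  orthomodular : ∀ a b : α, a ≤ b → b = a ⊔ (b ⊓ aᶜ)

namespace Ortholattice

variable {α : Type*} [Ortholattice α]

theorem compl_le_compl_iff {a b : α} : aᶜ ≤ bᶜ ↔ b ≤ a :=
  ⟨fun h => by simpa only [compl_invol] using compl_le_compl_of_le _ _ h, compl_le_compl_of_le _ _⟩

theorem le_compl_comm {a b : α} : a ≤ bᶜ ↔ b ≤ aᶜ := by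
  rw [← compl_le_compl_iff, compl_invol]

theorem compl_sup_eq (a b : α) : (a ⊔ b)ᶜ = aᶜ ⊓ bᶜ :=
  le_antisymm (le_inf (compl_le_compl_of_le _ _ le_sup_left) (compl_le_compl_of_le _ _ le_sup_right))
    (le_compl_comm.1 (sup_le (le_compl_comm.1 inf_le_left) (le_compl_comm.1 inf_le_right)))

theorem compl_inf_eq (a b : α) : (a ⊓ b)ᶜ = aᶜ ⊔ bᶜ := by
  rw [← compl_invol (aᶜ ⊔ bᶜ), compl_sup_eq, compl_invol, compl_invol]

theorem compl_bot_eq : (⊥ : α)ᶜ = ⊤ :=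
  top_le_iff.1 (le_compl_comm.1 bot_le)

theorem sup_compl_top (a : α) : a ⊔ aᶜ = ⊤ := by
  rw [← compl_bot_eq, ← inf_compl_bot aᶜ, compl_inf_eq, compl_invol]

theorem eq_bot_of_le_compl {a : α} (h : a ≤ aᶜ) : a = ⊥ := by
  rw [← inf_compl_bot a, inf_eq_left.2 h]

theorem not_le_of_le_compl {a b : α} (ha : a ≠ ⊥) (hb : b ≤ aᶜ) : ¬ a ≤ b :=
  fun h => ha (eq_bot_of_le_compl (h.trans hb))

/-- The orthomodular law holds as soon as comparable elements with trivial relative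
complement agree. -/
theorem orthomodular_of_inf_compl_eq_bot
    (H : ∀ a b : α, a ≤ b → b ⊓ aᶜ = ⊥ → a = b) (a b : α) (h : a ≤ b) :
    b = a ⊔ (b ⊓ aᶜ) := by
  refine (H _ _ (sup_le h inf_le_left) ?_).symm
  rw [compl_sup_eq, ← inf_assoc, inf_compl_bot]

end Ortholattice

namespace OrthomodularLattice

open Ortholattice

/-- The orthomodular law in dual form. -/
theorem sup_inf_compl_eq {α : Type*} [OrthomodularLattice α] {x y : α} (h : y ≤ xᶜ) :
    (y ⊔ x) ⊓ xᶜ = y := by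
  have h' := congrArg compl (orthomodular x yᶜ (le_compl_comm.1 h))
  rwa [compl_sup_eq, compl_inf_eq, compl_invol, compl_invol, inf_comm, eq_comm] at h'

end OrthomodularLattice

/-- An embedding of ortholattices; preservation of joins and bounds is automatic. -/
structure IsOrthoEmbedding {α β : Type*} [Ortholattice α] [Ortholattice β] (h : α → β) :
    Prop where
  injective : Function.Injective h
  map_inf : ∀ a b, h (a ⊓ b) = h a ⊓ h b
  map_compl : ∀ a, h aᶜ = (h a)ᶜ

namespace IsOrthoEmbedding

open Ortholattice

variable {α β γ : Type*} [Ortholattice α] [Ortholattice β] [Ortholattice γ] {h : α → β}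

theorem comp {g : β → γ} (hg : IsOrthoEmbedding g) (hh : IsOrthoEmbedding h) :
    IsOrthoEmbedding (g ∘ h) where
  injective := hg.injective.comp hh.injective
  map_inf a b := by simp [hh.map_inf, hg.map_inf]
  map_compl a := by simp [hh.map_compl, hg.map_compl]

theorem map_sup (hh : IsOrthoEmbedding h) (a b : α) : h (a ⊔ b) = h a ⊔ h b := by
  rw [← compl_invol (a ⊔ b), compl_sup_eq, hh.map_compl, hh.map_inf, compl_inf_eq,
    hh.map_compl, hh.map_compl, compl_invol, compl_invol]

theorem map_bot (hh : IsOrthoEmbedding h) : h ⊥ = ⊥ := by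
  rw [← inf_compl_bot (⊥ : α), hh.map_inf, hh.map_compl, inf_compl_bot]

theorem map_top (hh : IsOrthoEmbedding h) : h ⊤ = ⊤ := by
  rw [← compl_bot_eq, hh.map_compl, hh.map_bot, compl_bot_eq]

theorem le_iff_le (hh : IsOrthoEmbedding h) {a b : α} : h a ≤ h b ↔ a ≤ b := by
  rw [← inf_eq_left, ← hh.map_inf, hh.injective.eq_iff, inf_eq_left]

theorem lt_iff_lt (hh : IsOrthoEmbedding h) {a b : α} : h a < h b ↔ a < b := by
  rw [lt_iff_le_not_ge, hh.le_iff_le, hh.le_iff_le, lt_iff_le_not_ge]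

end IsOrthoEmbedding

/-- The elements of the extension of an orthomodular lattice in which `x` is split into two
new complementary parts indexed by `Bool`. The element `split y _ b` is the join of `y`,
which is orthogonal to `x`, and the part `b` of `x`. -/
inductive SplitExtension {α : Type*} [OrthomodularLattice α] (x : α) : Type _
  | of (z : α) : SplitExtension x
  | split (y : α) (hy : y ≤ xᶜ) (b : Bool) : SplitExtension x

namespace SplitExtension

open Ortholattice OrthomodularLattice

variable {α : Type*} [OrthomodularLattice α] {x : α}

instance [Finite α] : Finite (SplitExtension x) :=
  Finite.of_surjective
    (Sum.elim of fun p : {y : α // y ≤ xᶜ} × Bool => split p.1.1 p.1.2 p.2) fun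
    | of z => ⟨.inl z, rfl⟩
    | split y hy b => ⟨.inr (⟨y, hy⟩, b), rfl⟩

instance : LE (SplitExtension x) where
  le
    | of z, of w => z ≤ w
    | of z, split y _ _ => z ≤ y
    | split y _ _, of z => y ≤ z ∧ x ≤ z
    | split y _ b, split w _ c => y ≤ w ∧ b = c

@[simp] theorem of_le_of {z w : α} : (of z : SplitExtension x) ≤ of w ↔ z ≤ w := Iff.rfl

@[simp] theorem of_le_split {z y : α} {hy : y ≤ xᶜ} {b : Bool} :
    (of z : SplitExtension x) ≤ split y hy b ↔ z ≤ y := Iff.rfl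

@[simp] theorem split_le_of {z y : α} {hy : y ≤ xᶜ} {b : Bool} :
    (split y hy b : SplitExtension x) ≤ of z ↔ y ≤ z ∧ x ≤ z := Iff.rfl

@[simp] theorem split_le_split {y w : α} {hy : y ≤ xᶜ} {hw : w ≤ xᶜ} {b c : Bool} :
    (split y hy b : SplitExtension x) ≤ split w hw c ↔ y ≤ w ∧ b = c := Iff.rfl

instance : BoundedOrder (SplitExtension x) where
  top := of ⊤
  le_top p := by cases p <;> simp
  bot := of ⊥
  bot_le p := by cases p <;> simp

theorem bot_def : (⊥ : SplitExtension x) = of ⊥ := rfl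

instance : Compl (SplitExtension x) where
  compl
    | of z => of zᶜ
    | split y _ b => split (yᶜ ⊓ xᶜ) inf_le_right !b

@[simp] theorem compl_of (z : α) : (of z : SplitExtension x)ᶜ = of zᶜ := rfl

@[simp] theorem compl_split (y : α) (hy : y ≤ xᶜ) (b : Bool) :
    (split y hy b : SplitExtension x)ᶜ = split (yᶜ ⊓ xᶜ) inf_le_right !b := rfl

protected theorem compl_compl (p : SplitExtension x) : pᶜᶜ = p := by
  cases p with
  | of z => simp [compl_invol]
  | split y hy b => simp [compl_inf_eq, compl_invol, sup_inf_compl_eq hy]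

protected theorem compl_le_compl {p q : SplitExtension x} (h : p ≤ q) : qᶜ ≤ pᶜ := by
  cases p with
  | of z =>
    cases q with
    | of w => exact compl_le_compl_of_le z w h
    | split w hw c =>
      exact ⟨inf_le_left.trans (compl_le_compl_of_le _ _ h),
        le_compl_comm.1 (le_trans (α := α) h hw)⟩
  | split y hy b =>
    cases q with
    | of w => exact le_inf (compl_le_compl_of_le _ _ h.1) (compl_le_compl_of_le _ _ h.2)
    | split w hw c => exact ⟨inf_le_inf_right _ (compl_le_compl_of_le _ _ h.1), by rw [h.2]⟩

variable (x) in
/-- The new atom of a split extension lying below `x`. -/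
def atom : SplitExtension x := split ⊥ bot_le true

theorem atom_le_of_iff {y : α} : atom x ≤ of y ↔ x ≤ y := by simp [atom]

theorem atom_ne_of (y : α) : atom x ≠ of y := nofun

variable [Fact (x ≠ ⊥)]

instance : PartialOrder (SplitExtension x) where
  le_refl p := by cases p <;> simp
  le_trans
    | of _, of _, of _, h, k => le_trans (α := α) h k
    | of _, of _, split .., h, k => le_trans (α := α) h k
    | of _, split .., of _, h, k => le_trans (α := α) h k.1
    | of _, split .., split .., h, k => le_trans (α := α) h k.1
    | split .., of _, of _, h, k => ⟨le_trans h.1 k, le_trans h.2 k⟩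
    | split .., of _, split _ hw _, h, k =>
      absurd (le_trans (α := α) h.2 k) (not_le_of_le_compl Fact.out hw)
    | split .., split .., of _, h, k => ⟨le_trans h.1 k.1, k.2⟩
    | split .., split .., split .., h, k => ⟨le_trans h.1 k.1, h.2.trans k.2⟩
  le_antisymm
    | of _, of _, h, k => congrArg of (le_antisymm (α := α) h k)
    | of _, split _ hy _, h, k =>
      absurd (le_trans (α := α) k.2 h) (not_le_of_le_compl Fact.out hy)
    | split _ hy _, of _, h, k =>
      absurd (le_trans (α := α) h.2 k) (not_le_of_le_compl Fact.out hy)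
    | split _ _ _, split _ _ _, ⟨h, e⟩, ⟨k, _⟩ => by
      obtain rfl := le_antisymm h k
      rw [e]

open Classical in
/-- The meet of two elements of a split extension. -/
noncomputable def meet : SplitExtension x → SplitExtension x → SplitExtension x
  | of z, of w => of (z ⊓ w)
  | of z, split y hy b =>
    if x ≤ z then split (y ⊓ z) (inf_le_left.trans hy) b else of (y ⊓ z)
  | split y hy b, of z =>
    if x ≤ z then split (y ⊓ z) (inf_le_left.trans hy) b else of (y ⊓ z)
  | split y hy b, split w _ c =>
    if b = c then split (y ⊓ w) (inf_le_left.trans hy) b else of (y ⊓ w)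

theorem le_meet_iff {p q r : SplitExtension x} : r ≤ meet p q ↔ r ≤ p ∧ r ≤ q := by
  have h (y : α) (hy : y ≤ xᶜ) : ¬ x ≤ y := not_le_of_le_compl Fact.out hy
  cases p <;> cases q <;> cases r <;> simp only [meet] <;> (try split_ifs) <;>
    simp only [of_le_of, of_le_split, split_le_of, split_le_split, le_inf_iff] <;> grind

noncomputable instance : Lattice (SplitExtension x) where
  inf := meet
  inf_le_left _ _ := (le_meet_iff.1 le_rfl).1
  inf_le_right _ _ := (le_meet_iff.1 le_rfl).2
  le_inf _ _ _ h k := le_meet_iff.2 ⟨h, k⟩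
  sup p q := (meet pᶜ qᶜ)ᶜ
  le_sup_left p q := by
    simpa only [SplitExtension.compl_compl] using
      SplitExtension.compl_le_compl (le_meet_iff (p := pᶜ) (q := qᶜ).1 le_rfl).1
  le_sup_right p q := by
    simpa only [SplitExtension.compl_compl] using
      SplitExtension.compl_le_compl (le_meet_iff (p := pᶜ) (q := qᶜ).1 le_rfl).2
  sup_le p q r h k := by
    simpa only [SplitExtension.compl_compl] using
      SplitExtension.compl_le_compl (le_meet_iff.2
        ⟨SplitExtension.compl_le_compl h, SplitExtension.compl_le_compl k⟩)

theorem inf_def (p q : SplitExtension x) : p ⊓ q = meet p q := rfl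

noncomputable instance : Ortholattice (SplitExtension x) where
  compl_invol := SplitExtension.compl_compl
  compl_le_compl_of_le _ _ := SplitExtension.compl_le_compl
  inf_compl_bot p := by
    cases p with
    | of z => simp [inf_def, meet, bot_def, inf_compl_bot]
    | split y hy b => simp [inf_def, meet, bot_def, inf_compl_bot, ← inf_assoc]

noncomputable instance : OrthomodularLattice (SplitExtension x) where
  orthomodular := orthomodular_of_inf_compl_eq_bot fun p q h k => by
    rw [inf_def, bot_def] at k
    cases p with
    | of z =>
      cases q with
      | of w =>
        simp only [compl_of, meet, of.injEq] at k
        rw [orthomodular z w h, k, sup_bot_eq]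
      | split w hw c =>
        have hz : x ≤ zᶜ := le_compl_comm.1 (le_trans (α := α) h hw)
        simp [meet, hz] at k
    | split y hy b =>
      cases q with
      | of w => simp [meet, h.2] at k
      | split w hw c =>
        obtain ⟨h, rfl⟩ := h
        have hk : w ⊓ yᶜ = ⊥ := by
          simpa [meet, ← inf_assoc, inf_eq_left.2 (inf_le_left.trans hw)] using k
        have := orthomodular y w h
        rw [hk, sup_bot_eq] at this
        subst this
        rfl

theorem isOrthoEmbedding_of : IsOrthoEmbedding (of : α → SplitExtension x) where
  injective _ _ := of.inj
  map_inf _ _ := rfl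
  map_compl _ := rfl

theorem isAtom_atom : IsAtom (atom x) := by
  refine ⟨atom_ne_of _, fun p hp => ?_⟩
  cases p with
  | of z => rw [le_bot_iff.1 (of_le_split.1 hp.le), bot_def]
  | split y hy b =>
    obtain ⟨h, rfl⟩ := split_le_split.1 hp.le
    exact absurd hp.2 (by simp [atom])

theorem isAtom_of {z : α} (hz : IsAtom z) (hzx : z ≠ x) :
    IsAtom (of z : SplitExtension x) := by
  refine ⟨fun h => hz.1 (of.inj h), fun p hp => ?_⟩
  cases p with
  | of w => rw [hz.2 w (isOrthoEmbedding_of.lt_iff_lt.1 hp), bot_def]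
  | split y hy b =>
    exact absurd ((hz.le_iff.1 (split_le_of.1 hp.le).2).resolve_left Fact.out).symm hzx

end SplitExtension

/-- Transport of an orthomodular lattice structure along an equivalence. -/
abbrev Equiv.orthomodularLattice {α β : Type*} [OrthomodularLattice β] (e : α ≃ β) :
    OrthomodularLattice α :=
  letI := e.lattice
  { top := e.symm ⊤
    bot := e.symm ⊥
    compl a := e.symm (e a)ᶜ
    le_top a := show e a ≤ e (e.symm ⊤) by simp
    bot_le a := show e (e.symm ⊥) ≤ e a by simp
    compl_invol a := by simp [Ortholattice.compl_invol]
    compl_le_compl_of_le a b h := show e (e.symm (e b)ᶜ) ≤ e (e.symm (e a)ᶜ) by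
      simpa using Ortholattice.compl_le_compl_of_le _ _ h
    inf_compl_bot a := show e.symm (e a ⊓ e (e.symm (e a)ᶜ)) = e.symm ⊥ by
      rw [e.apply_symm_apply, Ortholattice.inf_compl_bot]
    orthomodular a b h :=
      show b = e.symm (e a ⊔ e (e.symm (e b ⊓ e (e.symm (e a)ᶜ)))) by
        rw [e.apply_symm_apply, e.apply_symm_apply,
          ← OrthomodularLattice.orthomodular _ _ (show e a ≤ e b from h), e.symm_apply_apply] }

theorem OrthomodularLattice.exists_type_zero (α : Type*) [OrthomodularLattice α] [Finite α] :
    ∃ (β : Type) (_ : OrthomodularLattice β) (_ : Finite β) (h : α → β), IsOrthoEmbedding h := by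
  obtain ⟨n, ⟨e⟩⟩ := Finite.exists_equiv_fin α
  let := e.symm.orthomodularLattice
  exact ⟨Fin n, inferInstance, inferInstance, e, e.injective,
    fun a b => show e (a ⊓ b) = e (e.symm (e a) ⊓ e.symm (e b)) by simp,
    fun a => show e aᶜ = e (e.symm (e a))ᶜ by simp⟩

open OrthomodularLattice in
theorem OrthomodularLattice.exists_atom_family {α : Type*} [OrthomodularLattice α] [Finite α]
    (n : ℕ) (x : Fin n → α) (hx : ∀ i, x i ≠ ⊥) :
    ∃ (β : Type) (_ : OrthomodularLattice β) (_ : Finite β) (h : α → β) (a : Fin n → β),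
      IsOrthoEmbedding h ∧ Function.Injective a ∧ (∀ i, IsAtom (a i)) ∧
      (∀ i, a i ∉ Set.range h) ∧ (∀ i y, a i ≤ h y ↔ x i ≤ y) ∧
      (∀ i j, a i ≤ (a j)ᶜ ↔ x i ≤ (x j)ᶜ) := by
  induction n with
  | zero =>
    obtain ⟨β, _, _, h, hh⟩ := exists_type_zero α
    exact ⟨β, _, ‹_›, h, Fin.elim0, hh, fun i => i.elim0, fun i => i.elim0, fun i => i.elim0,
      fun i => i.elim0, fun i => i.elim0⟩
  | succ n ih =>
    obtain ⟨β, _, _, h, a, hh, ha, hatom, hrange, hle, hperp⟩ :=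
      ih (fun i => x i.succ) fun i => hx i.succ
    have : Fact (h (x 0) ≠ ⊥) := ⟨fun e => hx 0 (hh.injective (e.trans hh.map_bot.symm))⟩
    have hle0 (y : α) : SplitExtension.atom (h (x 0)) ≤ .of (h y) ↔ x 0 ≤ y :=
      SplitExtension.atom_le_of_iff.trans hh.le_iff_le
    refine ⟨SplitExtension (h (x 0)), inferInstance, inferInstance, .of ∘ h,
      Fin.cons (.atom _) (.of ∘ a), SplitExtension.isOrthoEmbedding_of.comp hh,
      ?_, ?_, ?_, ?_, ?_⟩
    · rw [Fin.cons_injective_iff]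
      exact ⟨fun ⟨i, e⟩ => SplitExtension.atom_ne_of _ e.symm,
        SplitExtension.isOrthoEmbedding_of.injective.comp ha⟩
    · refine Fin.cases SplitExtension.isAtom_atom fun i => ?_
      exact SplitExtension.isAtom_of (hatom i) fun e => hrange i ⟨x 0, e.symm⟩
    · refine Fin.cases (fun ⟨y, e⟩ => SplitExtension.atom_ne_of _ e.symm) fun i => ?_
      rintro ⟨y, e⟩
      exact hrange i ⟨y, SplitExtension.of.inj e⟩
    · exact Fin.cases hle0 fun i y => hle i y
    · have hperp0 (i : Fin n) : SplitExtension.atom (h (x 0)) ≤ (.of (a i))ᶜ ↔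
          x 0 ≤ (x i.succ)ᶜ := by
        rw [SplitExtension.compl_of, SplitExtension.atom_le_of_iff,
          Ortholattice.le_compl_comm, ← hh.map_compl, hle, Ortholattice.le_compl_comm]
      refine Fin.cases (Fin.cases ?_ hperp0) fun i => Fin.cases ?_ fun j => hperp i j
      · exact iff_of_false
          (fun e => SplitExtension.isAtom_atom.1 (Ortholattice.eq_bot_of_le_compl e))
          (fun e => hx 0 (Ortholattice.eq_bot_of_le_compl e))
      · exact Ortholattice.le_compl_comm.trans ((hperp0 i).trans Ortholattice.le_compl_comm)

theorem coatom_extension_for_family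
    (L : Type*) [Fintype L] [Lattice L] [BoundedOrder L] (complL : L → L)
    (hL1 : ∀ x : L, complL (complL x) = x)
    (hL2 : ∀ x y : L, x ≤ y → complL y ≤ complL x)
    (hL3 : ∀ x : L, x ⊓ complL x = ⊥)
    (hL4 : ∀ x : L, x ⊔ complL x = ⊤)
    (hL5 : ∀ x y : L, x ≤ y → y = x ⊔ (y ⊓ complL x))
    (n : ℕ) (x : Fin n → L) (hxinj : Function.Injective x)
    (hxbot : ∀ i, x i ≠ ⊥) :
    ∃ (M : Type) (_ : Fintype M) (_ : Lattice M) (_ : BoundedOrder M) (complM : M → M),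
      (∀ p : M, complM (complM p) = p) ∧
      (∀ p q : M, p ≤ q → complM q ≤ complM p) ∧
      (∀ p : M, p ⊓ complM p = ⊥) ∧
      (∀ p : M, p ⊔ complM p = ⊤) ∧
      (∀ p q : M, p ≤ q → q = p ⊔ (q ⊓ complM p)) ∧
      ∃ h : L → M, Function.Injective h ∧
        (∀ y z : L, h (y ⊓ z) = h y ⊓ h z) ∧
        (∀ y z : L, h (y ⊔ z) = h y ⊔ h z) ∧
        (∀ y : L, h (complL y) = complM (h y)) ∧
        h ⊥ = ⊥ ∧ h ⊤ = ⊤ ∧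
        ∃ a : Fin n → M, Function.Injective a ∧
          (∀ i, IsAtom (a i)) ∧
          (∀ i, a i ∉ Set.range h) ∧
          (∀ i (y : L), a i ≤ h y ↔ x i ≤ y) ∧
          (∀ i j, a i ≤ complM (a j) ↔ x i ≤ complL (x j)) := by
  let _ : OrthomodularLattice L :=
    { compl := complL
      compl_invol := hL1
      compl_le_compl_of_le := hL2
      inf_compl_bot := hL3
      orthomodular := hL5 }
  obtain ⟨M, _, _, h, a, hh, ha, hatom, hrange, hle, hperp⟩ :=
    OrthomodularLattice.exists_atom_family n x hxbot
  exact ⟨M, Fintype.ofFinite M, inferInstance, inferInstance, compl,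
    Ortholattice.compl_invol, Ortholattice.compl_le_compl_of_le, Ortholattice.inf_compl_bot,
    Ortholattice.sup_compl_top, OrthomodularLattice.orthomodular, h, hh.injective,
    hh.map_inf, hh.map_sup, hh.map_compl, hh.map_bot, hh.map_top, a, ha, hatom, hrange,
    hle, hperp⟩
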